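/- arXiv:1907.05830 — 9 statements merged into one kernel-verified Lean document; each statement's English description precedes it below -/
import Mathlib

section
/- Strong duality and link equation for the Lasso: if β̂ ∈ ℝ^p minimizes P over ℝ^p, then the point θ̂ = (y − Xβ̂)/λ satisfies ‖Xᵀθ̂‖_∞ ≤ 1 (i.e. θ̂ ∈ Δ_X) and D(θ̂) = P(β̂). -/
open Finset

/-- A bound up to an error vanishing linearly in `t ∈ (0, 1]` holds without the error. -/
lemma le_of_forall_le_add_mul {a b K : ℝ}
    (h : ∀ t : ℝ, 0 < t → t ≤ 1 → a ≤ b + t * K) : a ≤ b := by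
  refine le_of_forall_pos_le_add fun ε hε => ?_
  have hK : 0 < |K| + 1 := by positivity
  have ht : 0 < min 1 (ε / (|K| + 1)) := lt_min one_pos (by positivity)
  have hle : min 1 (ε / (|K| + 1)) * (|K| + 1) ≤ ε :=
    (le_div_iff₀ hK).1 (min_le_right _ _)
  have h1 := h _ ht (min_le_left _ _)
  nlinarith [mul_le_mul_of_nonneg_left (le_abs_self K) ht.le]

/-- First-order condition for a minimizer of the Lasso objective: if the `ℓ¹` norm grows with rate
at most `c` in the direction `d`, the correlation of the residual with `X d` is at most `λ c`. -/
lemma lasso_residual_correlation_le {ι κ : Type*} [Fintype ι] [Fintype κ] (X : Matrix ι κ ℝ)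
    (y : ι → ℝ) {lam : ℝ} (hlam : 0 ≤ lam) (betah : κ → ℝ)
    (hmin : ∀ beta : κ → ℝ,
      (1 / 2) * ∑ i, (y i - X.mulVec betah i) ^ 2 + lam * ∑ j, |betah j| ≤
        (1 / 2) * ∑ i, (y i - X.mulVec beta i) ^ 2 + lam * ∑ j, |beta j|)
    (d : κ → ℝ) (c : ℝ)
    (hd : ∀ t : ℝ, 0 < t → t ≤ 1 → ∑ j, |betah j + t * d j| ≤ ∑ j, |betah j| + t * c) :
    ∑ i, (y i - X.mulVec betah i) * X.mulVec d i ≤ lam * c := by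
  refine le_of_forall_le_add_mul (K := (1 / 2) * ∑ i, X.mulVec d i ^ 2) fun t ht ht1 => ?_
  have hm := hmin (betah + t • d)
  have hsq : ∑ i, (y i - X.mulVec (betah + t • d) i) ^ 2 =
      ∑ i, (y i - X.mulVec betah i) ^ 2
        - 2 * t * ∑ i, (y i - X.mulVec betah i) * X.mulVec d i
        + t ^ 2 * ∑ i, X.mulVec d i ^ 2 := by
    rw [mul_sum, mul_sum, ← sum_sub_distrib, ← sum_add_distrib]
    refine sum_congr rfl fun i _ => ?_
    simp only [Matrix.mulVec_add, Matrix.mulVec_smul, Pi.add_apply, Pi.smul_apply, smul_eq_mul]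
    ring
  rw [hsq] at hm
  simp only [Pi.add_apply, Pi.smul_apply, smul_eq_mul] at hm
  have hl := mul_le_mul_of_nonneg_left (hd t ht ht1) hlam
  refine le_of_mul_le_mul_left ?_ ht
  linarith

/-- Strong duality and link equation for the Lasso: if `β̂` minimizes the primal
objective `P`, then `θ̂ = (y − Xβ̂)/λ` is dual feasible (`‖Xᵀθ̂‖_∞ ≤ 1`) and
achieves `D(θ̂) = P(β̂)`. -/
theorem lasso_strong_duality (n p : ℕ) (X : Matrix (Fin n) (Fin p) ℝ)
    (y : Fin n → ℝ) (lam : ℝ) (hlam : 0 < lam)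
    (betah : Fin p → ℝ)
    (hmin : ∀ beta : Fin p → ℝ,
      (1 / 2) * ∑ i, (y i - X.mulVec betah i) ^ 2 + lam * ∑ j, |betah j| ≤
        (1 / 2) * ∑ i, (y i - X.mulVec beta i) ^ 2 + lam * ∑ j, |beta j|) :
    (∀ j, |∑ i, X i j * ((y i - X.mulVec betah i) / lam)| ≤ 1) ∧
    (1 / 2) * ∑ i, (y i) ^ 2 -
        (lam ^ 2 / 2) * ∑ i, (y i / lam - (y i - X.mulVec betah i) / lam) ^ 2 =
      (1 / 2) * ∑ i, (y i - X.mulVec betah i) ^ 2 + lam * ∑ j, |betah j| := by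
  have key := lasso_residual_correlation_le X y hlam.le betah hmin
  have coord : ∀ (j : Fin p) (s : ℝ), |s| = 1 →
      s * ∑ i, X i j * (y i - X.mulVec betah i) ≤ lam := by
    intro j s hs
    have h := key (Pi.single j s) 1 fun t ht _ => by
      calc ∑ k, |betah k + t * (Pi.single j s : Fin p → ℝ) k|
          ≤ ∑ k, (|betah k| + (Pi.single j t : Fin p → ℝ) k) := by
            refine sum_le_sum fun k _ => (abs_add_le _ _).trans ?_
            rcases eq_or_ne k j with rfl | hk
            · simp [abs_mul, hs, abs_of_pos ht]
            · simp [hk]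
        _ = ∑ k, |betah k| + t * 1 := by simp [sum_add_distrib]
    rw [mul_one] at h
    refine le_of_eq_of_le ?_ h
    rw [mul_sum]
    refine sum_congr rfl fun i _ => ?_
    simp only [Matrix.mulVec_single, Pi.smul_apply, MulOpposite.smul_eq_mul_unop,
      MulOpposite.unop_op, Matrix.col_apply]
    ring
  have hcorr : ∑ i, (y i - X.mulVec betah i) * X.mulVec betah i = lam * ∑ j, |betah j| := by
    have scale : ∀ s : ℝ, 0 ≤ s →
        ∑ j, |s * betah j| = s * ∑ j, |betah j| := fun s hs => by
      simp only [abs_mul, abs_of_nonneg hs, mul_sum]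
    refine le_antisymm (key betah _ fun t ht _ => ?_) ?_
    · have h := scale (1 + t) (by linarith)
      simp only [add_mul, one_mul] at h
      exact h.le
    · have h := key (-betah) (-∑ j, |betah j|) fun t _ ht1 => by
        have h := scale (1 - t) (by linarith)
        simp only [sub_mul, one_mul] at h
        simp only [Pi.neg_apply, mul_neg, ← sub_eq_add_neg]
        exact h.le
      simp only [Matrix.mulVec_neg, Pi.neg_apply, mul_neg, sum_neg_distrib] at h
      linarith
  refine ⟨fun j => ?_, ?_⟩
  · simp only [← mul_div_assoc, ← sum_div]
    rw [abs_div, abs_of_pos hlam, div_le_one hlam, abs_le]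
    constructor
    · linarith [coord j (-1) (by simp)]
    · linarith [coord j 1 (by simp)]
  · rw [← hcorr]
    simp only [mul_sum]
    rw [← sum_sub_distrib, ← sum_add_distrib]
    refine sum_congr rfl fun i _ => ?_
    field_simp
    ring
end

section
/- Gap Safe screening rule for the Lasso: let β̂ be a minimizer of P. For every j ∈ [p] with x_j ≠ 0, every β ∈ ℝ^p and every θ ∈ ℝ^n with ‖Xᵀθ‖_∞ ≤ 1, if (1 − |x_jᵀθ|)/‖x_j‖ > sqrt(2(P(β) − D(θ))/λ²), then β̂_j = 0. -/
open Finset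

/-- If the linear-plus-quadratic perturbation `s ↦ s ^ 2 * q - s * c` is nonnegative on `(0, 1]`,
then its linear coefficient satisfies `c ≤ 0`. -/
theorem nonpos_of_forall_mul_le_sq_mul {c q : ℝ}
    (h : ∀ s : ℝ, 0 < s → s ≤ 1 → s * c ≤ s ^ 2 * q) : c ≤ 0 := by
  by_contra! hc
  have hq : c ≤ q := by simpa using h 1 one_pos le_rfl
  have hq0 : 0 < q := hc.trans_le hq
  have hs := h (c / (2 * q)) (by positivity) (by rw [div_le_one (by positivity)]; linarith)
  have h1 : c / (2 * q) * c = c ^ 2 / q / 2 := by field_simp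
  have h2 : (c / (2 * q)) ^ 2 * q = c ^ 2 / q / 4 := by field_simp; norm_num
  have h3 : 0 < c ^ 2 / q := by positivity
  linarith

/-- On the support of a Lasso minimizer, the correlation of the corresponding column with the
residual is at least `lam` in absolute value. -/
theorem lasso_le_abs_correlation_of_ne_zero {n p : ℕ} (X : Matrix (Fin n) (Fin p) ℝ)
    (y : Fin n → ℝ) (lam : ℝ) (betah : Fin p → ℝ)
    (hmin : ∀ beta : Fin p → ℝ,
      (1 / 2) * ∑ i, (y i - X.mulVec betah i) ^ 2 + lam * ∑ j, |betah j| ≤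
        (1 / 2) * ∑ i, (y i - X.mulVec beta i) ^ 2 + lam * ∑ j, |beta j|)
    (j : Fin p) (hj : betah j ≠ 0) :
    lam ≤ |∑ i, X i j * (y i - X.mulVec betah i)| := by
  set b := betah j
  set A := ∑ i, X i j * (y i - X.mulVec betah i) with hA
  have key : lam * |b| - b * A ≤ 0 := by
    refine nonpos_of_forall_mul_le_sq_mul (q := b ^ 2 * (∑ i, X i j ^ 2) / 2) fun s hs hs1 => ?_
    have hm := hmin (betah + Pi.single j (-(s * b)))
    have hquad : ∑ i, (y i - X.mulVec (betah + Pi.single j (-(s * b))) i) ^ 2 =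
        ∑ i, (y i - X.mulVec betah i) ^ 2 + 2 * (s * b) * A +
          (s * b) ^ 2 * ∑ i, X i j ^ 2 := by
      rw [hA, Finset.mul_sum, Finset.mul_sum, ← Finset.sum_add_distrib,
        ← Finset.sum_add_distrib]
      refine Finset.sum_congr rfl fun i _ => ?_
      simp only [Matrix.mulVec_add, Pi.add_apply, Matrix.mulVec_single, Pi.smul_apply,
        Matrix.col_apply, MulOpposite.smul_eq_mul_unop, MulOpposite.unop_op]
      ring
    have habs : ∑ k, |(betah + Pi.single j (-(s * b)) : Fin p → ℝ) k| = ∑ k, |betah k| - s * |b| := by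
      have hk : ∀ k, |(betah + Pi.single j (-(s * b)) : Fin p → ℝ) k| =
          |betah k| - if k = j then s * |b| else 0 := by
        intro k
        by_cases h : k = j
        · subst h
          have : b + -(s * b) = (1 - s) * b := by ring
          simp only [Pi.add_apply, Pi.single_eq_same, if_true]
          change |b + -(s * b)| = |b| - s * |b|
          rw [this, abs_mul, abs_of_nonneg (by linarith)]
          ring
        · simp [h]
      rw [Finset.sum_congr rfl fun k _ => hk k]
      simp [Finset.sum_sub_distrib]
    rw [hquad, habs] at hm
    nlinarith [hm]
  have hb : 0 < |b| := abs_pos.mpr hj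
  have hbA : b * A ≤ |b| * |A| := by rw [← abs_mul]; exact le_abs_self _
  exact le_of_mul_le_mul_left (by linarith) hb

/-- The Lasso duality gap at a dual feasible point `theta` bounds half the squared distance from
`lam * theta` to the residual. -/
theorem lasso_half_sum_sq_le_gap {n p : ℕ} (X : Matrix (Fin n) (Fin p) ℝ)
    (y : Fin n → ℝ) (lam : ℝ) (hlam : 0 < lam) (beta : Fin p → ℝ) (theta : Fin n → ℝ)
    (hfeas : ∀ j, |∑ i, X i j * theta i| ≤ 1) :
    (1 / 2) * ∑ i, (y i - X.mulVec beta i - lam * theta i) ^ 2 ≤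
      ((1 / 2) * ∑ i, (y i - X.mulVec beta i) ^ 2 + lam * ∑ j, |beta j|) -
        ((1 / 2) * ∑ i, (y i) ^ 2 - (lam ^ 2 / 2) * ∑ i, (y i / lam - theta i) ^ 2) := by
  have hpair : ∑ i, X.mulVec beta i * theta i ≤ ∑ j, |beta j| := by
    have hswap : ∑ i, X.mulVec beta i * theta i = ∑ j, beta j * ∑ i, X i j * theta i := by
      simp only [Matrix.mulVec, dotProduct, Finset.sum_mul, Finset.mul_sum]
      rw [Finset.sum_comm]
      refine Finset.sum_congr rfl fun k _ => Finset.sum_congr rfl fun i _ => ?_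
      ring
    rw [hswap]
    refine Finset.sum_le_sum fun k _ => (le_abs_self _).trans ?_
    rw [abs_mul]
    exact mul_le_of_le_one_right (abs_nonneg _) (hfeas k)
  have hid : (1 / 2) * ∑ i, (y i - X.mulVec beta i - lam * theta i) ^ 2 =
      (1 / 2) * ∑ i, (y i - X.mulVec beta i) ^ 2 - (1 / 2) * ∑ i, (y i) ^ 2 +
        (lam ^ 2 / 2) * ∑ i, (y i / lam - theta i) ^ 2 +
          lam * ∑ i, X.mulVec beta i * theta i := by
    simp only [Finset.mul_sum]
    rw [← Finset.sum_sub_distrib, ← Finset.sum_add_distrib, ← Finset.sum_add_distrib]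
    refine Finset.sum_congr rfl fun i _ => ?_
    field_simp
    ring
  have := mul_le_mul_of_nonneg_left hpair hlam.le
  linarith

/-- Gap Safe screening rule for the Lasso: if `β̂` minimizes the primal objective,
then for any `j` with `x_j ≠ 0`, any primal point `β` and any dual feasible `θ`
(`‖Xᵀθ‖_∞ ≤ 1`), the inequality
`(1 − |x_jᵀθ|)/‖x_j‖ > sqrt(2(P(β) − D(θ))/λ²)` implies `β̂_j = 0`. -/
theorem lasso_gap_safe_screening (n p : ℕ) (X : Matrix (Fin n) (Fin p) ℝ)
    (y : Fin n → ℝ) (lam : ℝ) (hlam : 0 < lam)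
    (betah : Fin p → ℝ)
    (hmin : ∀ beta : Fin p → ℝ,
      (1 / 2) * ∑ i, (y i - X.mulVec betah i) ^ 2 + lam * ∑ j, |betah j| ≤
        (1 / 2) * ∑ i, (y i - X.mulVec beta i) ^ 2 + lam * ∑ j, |beta j|)
    (j : Fin p) (hxj : (fun i => X i j) ≠ 0)
    (beta : Fin p → ℝ) (theta : Fin n → ℝ)
    (hfeas : ∀ j', |∑ i, X i j' * theta i| ≤ 1)
    (hscreen : (1 - |∑ i, X i j * theta i|) / Real.sqrt (∑ i, (X i j) ^ 2) >
      Real.sqrt (2 * (((1 / 2) * ∑ i, (y i - X.mulVec beta i) ^ 2 + lam * ∑ j', |beta j'|) -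
        ((1 / 2) * ∑ i, (y i) ^ 2 - (lam ^ 2 / 2) * ∑ i, (y i / lam - theta i) ^ 2)) / lam ^ 2)) :
    betah j = 0 := by
  by_contra hj
  have hcorr := lasso_le_abs_correlation_of_ne_zero X y lam betah hmin j hj
  have hgap := (lasso_half_sum_sq_le_gap X y lam hlam betah theta hfeas).trans
    (sub_le_sub_right (hmin beta) _)
  set G := ((1 / 2) * ∑ i, (y i - X.mulVec beta i) ^ 2 + lam * ∑ j', |beta j'|) -
    ((1 / 2) * ∑ i, (y i) ^ 2 - (lam ^ 2 / 2) * ∑ i, (y i / lam - theta i) ^ 2)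
  set d : Fin n → ℝ := fun i => y i - X.mulVec betah i - lam * theta i with hd
  set T := ∑ i, X i j * theta i with hT
  have hS : 0 < ∑ i, (X i j) ^ 2 := by
    obtain ⟨i, hi⟩ := Function.ne_iff.mp hxj
    exact Finset.sum_pos' (fun i _ => sq_nonneg _)
      ⟨i, Finset.mem_univ i, sq_pos_of_ne_zero hi⟩
  have hsplit : ∑ i, X i j * (y i - X.mulVec betah i) = ∑ i, X i j * d i + lam * T := by
    rw [hT, Finset.mul_sum, ← Finset.sum_add_distrib]
    refine Finset.sum_congr rfl fun i _ => ?_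
    simp only [hd]
    ring
  have hcs : |∑ i, X i j * d i| ≤ √(∑ i, (X i j) ^ 2) * √(∑ i, (d i) ^ 2) := by
    rw [← Real.sqrt_mul hS.le]
    exact Real.abs_le_sqrt (Finset.sum_mul_sq_le_sq_mul_sq _ _ _)
  have hdist : √(∑ i, (d i) ^ 2) ≤ lam * √(2 * G / lam ^ 2) := by
    rw [Real.sqrt_div' _ (sq_nonneg lam), Real.sqrt_sq hlam.le, mul_div_cancel₀ _ hlam.ne']
    exact Real.sqrt_le_sqrt (by linarith)
  have hlow : lam * (1 - |T|) ≤ |∑ i, X i j * d i| := by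
    have h := abs_add_le (∑ i, X i j * d i) (lam * T)
    rw [abs_mul, abs_of_pos hlam, ← hsplit] at h
    linarith
  have hroot := Real.sqrt_pos.mpr hS
  rw [gt_iff_lt, lt_div_iff₀ hroot] at hscreen
  have h1 := mul_lt_mul_of_pos_left hscreen hlam
  have h2 := mul_le_mul_of_nonneg_left hdist hroot.le
  linarith
end

section
/- Fixed point of a contractive VAR sequence lies in the span of the last n+1 iterates: let A ∈ ℝ^{n×n} with spectral norm ‖A‖₂ < 1, b ∈ ℝ^n, let r̂ be the unique point with r̂ = A r̂ + b, and let (r^{(t)})_{t∈ℕ} satisfy r^{(t+1)} = A r^{(t)} + b for all t. Then for every t ≥ n, r̂ belongs to the linear span of {r^{(t−n)}, r^{(t−n+1)}, …, r^{(t)}}; more precisely, if a_0,…,a_n are the coefficients of the characteristic polynomial of A (which satisfy Σ_{k=0}^n a_k ≠ 0 since 1 is not an eigenvalue of A), then r̂ = Σ_{k=0}^n (a_k / Σ_{l=0}^n a_l) r^{(t−n+k)}. -/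
open Finset

/-- A matrix whose spectral norm is less than one fixes no nonzero vector. -/
theorem Matrix.eq_zero_of_mulVec_eq_self_of_norm_lt_one {n : ℕ} {A : Matrix (Fin n) (Fin n) ℝ}
    (hA : ‖Matrix.toEuclideanCLM (𝕜 := ℝ) A‖ < 1) {v : Fin n → ℝ} (hv : A.mulVec v = v) :
    v = 0 := by
  have hfix : Matrix.toEuclideanCLM (𝕜 := ℝ) A (WithLp.toLp 2 v) = WithLp.toLp 2 v := by
    rw [Matrix.toEuclideanCLM_toLp, hv]
  have hle := (Matrix.toEuclideanCLM (𝕜 := ℝ) A).le_opNorm (WithLp.toLp 2 v)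
  rw [hfix] at hle
  have hnorm : ‖WithLp.toLp 2 v‖ = 0 := by
    nlinarith [norm_nonneg (WithLp.toLp 2 v)]
  simpa using hnorm

/-- If `A` fixes no nonzero vector, then `1` is not a root of its characteristic polynomial. -/
theorem Matrix.eval_one_charpoly_ne_zero {n : ℕ} {A : Matrix (Fin n) (Fin n) ℝ}
    (hA : ∀ v, A.mulVec v = v → v = 0) : A.charpoly.eval 1 ≠ 0 := by
  intro h
  rw [Matrix.eval_charpoly] at h
  obtain ⟨v, hv, hv'⟩ := Matrix.exists_mulVec_eq_zero_iff.mpr h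
  rw [map_one, Matrix.sub_mulVec, Matrix.one_mulVec, sub_eq_zero] at hv'
  exact hv (hA v hv'.symm)

/-- The deviation of a VAR sequence from a fixed point evolves by powers of the matrix. -/
theorem var_sub_fixed_point {n : ℕ} {A : Matrix (Fin n) (Fin n) ℝ} {b rhat : Fin n → ℝ}
    (hfix : rhat = A.mulVec rhat + b) {r : ℕ → Fin n → ℝ}
    (hr : ∀ t, r (t + 1) = A.mulVec (r t) + b) (s k : ℕ) :
    r (s + k) - rhat = (A ^ k).mulVec (r s - rhat) := by
  induction k with
  | zero => simp
  | succ k ih =>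
    rw [pow_succ', ← Matrix.mulVec_mulVec, ← ih, ← add_assoc, hr, Matrix.mulVec_sub]
    nth_rewrite 1 [hfix]
    abel

/-- The coefficients of the characteristic polynomial annihilate the deviations of a VAR sequence
from a fixed point. -/
theorem sum_charpoly_coeff_smul_var_sub {n : ℕ} {A : Matrix (Fin n) (Fin n) ℝ}
    {b rhat : Fin n → ℝ} (hfix : rhat = A.mulVec rhat + b) {r : ℕ → Fin n → ℝ}
    (hr : ∀ t, r (t + 1) = A.mulVec (r t) + b) (s : ℕ) :
    ∑ k ∈ Finset.range (n + 1), A.charpoly.coeff k • (r (s + k) - rhat) = 0 := by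
  have hCH := Matrix.aeval_self_charpoly A
  rw [Polynomial.aeval_eq_sum_range, Matrix.charpoly_natDegree_eq_dim, Fintype.card_fin] at hCH
  simp_rw [var_sub_fixed_point hfix hr, ← Matrix.smul_mulVec, ← Matrix.sum_mulVec, hCH,
    Matrix.zero_mulVec]

/-- For a contractive VAR sequence `r^{(t+1)} = A r^{(t)} + b` with spectral norm
`‖A‖₂ < 1` and fixed point `r̂ = A r̂ + b`, for every `t ≥ n` the fixed point is the
affine combination of the last `n+1` iterates given by the normalized coefficients
of the characteristic polynomial of `A`; in particular the normalization is valid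
(`∑ a_k ≠ 0`) and `r̂` lies in the span of `r^{(t−n)}, …, r^{(t)}`. -/
theorem var_fixed_point_in_span (n : ℕ) (A : Matrix (Fin n) (Fin n) ℝ)
    (hA : ‖Matrix.toEuclideanCLM (𝕜 := ℝ) A‖ < 1)
    (b : Fin n → ℝ) (rhat : Fin n → ℝ) (hfix : rhat = A.mulVec rhat + b)
    (r : ℕ → Fin n → ℝ) (hr : ∀ t, r (t + 1) = A.mulVec (r t) + b) :
    (∑ k ∈ Finset.range (n + 1), (Matrix.charpoly A).coeff k) ≠ 0 ∧
    ∀ t, n ≤ t →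
      rhat = (∑ k ∈ Finset.range (n + 1),
        ((Matrix.charpoly A).coeff k /
          ∑ l ∈ Finset.range (n + 1), (Matrix.charpoly A).coeff l) • r (t - n + k)) ∧
      rhat ∈ Submodule.span ℝ (Set.range fun k : Fin (n + 1) => r (t - n + (k : ℕ))) := by
  have hsum : ∑ k ∈ Finset.range (n + 1), A.charpoly.coeff k ≠ 0 := by
    have h := Matrix.eval_one_charpoly_ne_zero
      fun v => Matrix.eq_zero_of_mulVec_eq_self_of_norm_lt_one hA (v := v)
    simpa [Polynomial.eval_eq_sum_range, Matrix.charpoly_natDegree_eq_dim] using h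
  refine ⟨hsum, fun t _ => ?_⟩
  have hcomb : rhat = ∑ k ∈ Finset.range (n + 1), (A.charpoly.coeff k /
      ∑ l ∈ Finset.range (n + 1), A.charpoly.coeff l) • r (t - n + k) := by
    have h := sum_charpoly_coeff_smul_var_sub hfix hr (t - n)
    simp_rw [smul_sub, Finset.sum_sub_distrib, ← Finset.sum_smul] at h
    simp_rw [div_eq_inv_mul, mul_smul, ← Finset.smul_sum]
    rw [sub_eq_zero.mp h, inv_smul_smul₀ hsum]
  refine ⟨hcomb, ?_⟩
  rw [hcomb]
  refine Submodule.sum_mem _ fun k hk => Submodule.smul_mem _ _ (Submodule.subset_span ?_)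
  exact ⟨⟨k, Finset.mem_range.mp hk⟩, rfl⟩
end

section
/- If the Gram matrix of successive differences of a convergent VAR sequence is singular, the limit lies in the span of the last K iterates: let (r^{(t)})_{t∈ℕ} ⊂ ℝ^n satisfy r^{(t+1)} = A r^{(t)} + b for all t, with A ∈ ℝ^{n×n}, b ∈ ℝ^n, and suppose r^{(t)} converges to r̂. Fix t ≥ K and set U = [r^{(t−K+1)} − r^{(t−K)} | … | r^{(t)} − r^{(t−1)}] ∈ ℝ^{n×K}. If UᵀU is not invertible, then r^{(s)} ∈ span(r^{(t−K)}, …, r^{(t−1)}) for all s ≥ t, and consequently r̂ ∈ span(r^{(t−K)}, …, r^{(t−1)}). -/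
open Finset Matrix

/-- A linearly dependent finite sequence has a term in the span of the preceding ones. -/
theorem exists_mem_span_image_Iio_of_not_linearIndependent {V : Type*} [AddCommGroup V]
    [Module ℝ V] (d : ℕ → V) (K : ℕ)
    (h : ¬ LinearIndependent ℝ fun k : Fin K => d k) :
    ∃ j < K, d j ∈ Submodule.span ℝ (d '' Set.Iio j) := by
  induction K with
  | zero => exact absurd linearIndependent_empty_type h
  | succ K ih =>
    rw [linearIndependent_finSucc', not_and_or, not_not] at h
    rcases h with h | h
    · obtain ⟨j, hj, hmem⟩ := ih h
      exact ⟨j, hj.trans K.lt_succ_self, hmem⟩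
    · refine ⟨K, K.lt_succ_self, Submodule.span_mono ?_ h⟩
      rintro _ ⟨k, rfl⟩
      exact ⟨k, k.2, rfl⟩

/-- If a term of the orbit of a linear map lies in the span of the preceding terms, then so
does the whole orbit. -/
theorem orbit_mem_span_image_Iio {V : Type*} [AddCommGroup V] [Module ℝ V]
    (f : V →ₗ[ℝ] V) (d : ℕ → V) (hd : ∀ k, d (k + 1) = f (d k)) (j : ℕ)
    (hj : d j ∈ Submodule.span ℝ (d '' Set.Iio j)) (s : ℕ) :
    d s ∈ Submodule.span ℝ (d '' Set.Iio j) := by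
  have le_j : ∀ k ≤ j, d k ∈ Submodule.span ℝ (d '' Set.Iio j) := by
    intro k hk
    rcases hk.lt_or_eq with hk | rfl
    · exact Submodule.subset_span ⟨k, hk, rfl⟩
    · exact hj
  have invariant : Submodule.span ℝ (d '' Set.Iio j) ≤
      (Submodule.span ℝ (d '' Set.Iio j)).comap f := by
    rw [Submodule.span_le]
    rintro _ ⟨k, hk, rfl⟩
    rw [SetLike.mem_coe, Submodule.mem_comap, ← hd]
    exact le_j _ hk
  induction s with
  | zero => exact le_j 0 j.zero_le
  | succ s ih =>
    rw [hd]
    exact invariant ih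

/-- The Gram matrix of a real matrix with linearly independent columns is invertible. -/
theorem isUnit_transpose_mul_self_of_linearIndependent_col {m k : Type*} [Fintype m]
    [Fintype k] [DecidableEq k] (U : Matrix m k ℝ) (h : LinearIndependent ℝ U.col) :
    IsUnit (Uᵀ * U) := by
  rw [← Matrix.mulVec_injective_iff_isUnit]
  rw [← Matrix.mulVec_injective_iff] at h
  have hker := Matrix.ker_mulVecLin_transpose_mul_self U
  rw [(LinearMap.ker_eq_bot (f := U.mulVecLin)).mpr h] at hker
  exact LinearMap.ker_eq_bot.mp hker

/-- If the Gram matrix `UᵀU` of the successive differences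
`U = [r^{(t−K+1)} − r^{(t−K)} | … | r^{(t)} − r^{(t−1)}]` of a convergent VAR sequence
`r^{(t+1)} = A r^{(t)} + b` is singular, then all subsequent iterates `r^{(s)}`, `s ≥ t`,
and hence the limit `r̂`, lie in the span of `r^{(t−K)}, …, r^{(t−1)}`. -/
theorem var_singular_gram_span (n K : ℕ) (A : Matrix (Fin n) (Fin n) ℝ) (b : Fin n → ℝ)
    (r : ℕ → Fin n → ℝ) (hr : ∀ t, r (t + 1) = A.mulVec (r t) + b)
    (rhat : Fin n → ℝ) (hconv : Filter.Tendsto r Filter.atTop (nhds rhat))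
    (t : ℕ) (ht : K ≤ t)
    (hU : ¬ IsUnit
      ((Matrix.of fun (i : Fin n) (k : Fin K) =>
          r (t - K + (k : ℕ) + 1) i - r (t - K + (k : ℕ)) i)ᵀ *
        (Matrix.of fun (i : Fin n) (k : Fin K) =>
          r (t - K + (k : ℕ) + 1) i - r (t - K + (k : ℕ)) i))) :
    (∀ s, t ≤ s →
      r s ∈ Submodule.span ℝ (Set.range fun k : Fin K => r (t - K + (k : ℕ)))) ∧
    rhat ∈ Submodule.span ℝ (Set.range fun k : Fin K => r (t - K + (k : ℕ))) := by
  set S := Submodule.span ℝ (Set.range fun k : Fin K => r (t - K + (k : ℕ)))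
  set d : ℕ → Fin n → ℝ := fun k => r (t - K + k + 1) - r (t - K + k) with hd
  have hdep : ¬ LinearIndependent ℝ fun k : Fin K => d k :=
    fun h => hU (isUnit_transpose_mul_self_of_linearIndependent_col _ h)
  have hstep : ∀ k, d (k + 1) = A.mulVecLin (d k) := by
    intro k
    simp only [hd, Matrix.mulVecLin_apply, Matrix.mulVec_sub]
    rw [← add_assoc, hr (t - K + k + 1), hr (t - K + k), add_sub_add_right_eq_sub]
  obtain ⟨j, hjK, hj⟩ := exists_mem_span_image_Iio_of_not_linearIndependent d K hdep
  have hr_mem : ∀ k < K, r (t - K + k) ∈ S :=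
    fun k hk => Submodule.subset_span ⟨⟨k, hk⟩, rfl⟩
  have hdS : Submodule.span ℝ (d '' Set.Iio j) ≤ S := by
    rw [Submodule.span_le]
    rintro _ ⟨k, hk, rfl⟩
    have hk : k < j := hk
    exact S.sub_mem (hr_mem (k + 1) (by omega)) (hr_mem k (by omega))
  have hmem : ∀ k, r (t - K + k) ∈ S := by
    intro k
    induction k with
    | zero => exact hr_mem 0 (by omega)
    | succ k ih =>
      have h := S.add_mem (hdS (orbit_mem_span_image_Iio _ d hstep j hj k)) ih
      simpa [hd, add_assoc] using h
  have hiter : ∀ s, t ≤ s → r s ∈ S := by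
    intro s hs
    have h := hmem (s - (t - K))
    rwa [Nat.add_sub_cancel' (by omega)] at h
  exact ⟨hiter, S.closed_of_finiteDimensional.mem_of_tendsto hconv
    (Filter.eventually_atTop.mpr ⟨t, hiter⟩)⟩
end

section
/- VAR structure of one epoch of cyclic coordinate descent for the Lasso after sign identification: let j_1 < … < j_S be indices with x_{j_s} ≠ 0, and let σ_s ∈ {−1, +1} for s ∈ [S]. Let β̃^{(0)} ∈ ℝ^p have support contained in {j_1,…,j_S}, and for s = 1,…,S define β̃^{(s)} ∈ ℝ^p equal to β̃^{(s−1)} everywhere except in coordinate j_s, where β̃^{(s)}_{j_s} = ST(β̃^{(s−1)}_{j_s} + x_{j_s}ᵀ(y − Xβ̃^{(s−1)})/‖x_{j_s}‖², λ/‖x_{j_s}‖²). Assume that for each s ∈ [S] the updated value satisfies sign(β̃^{(s)}_{j_s}) = σ_s ≠ 0. Define, for s ∈ [S], A_s = Id_n − x_{j_s}x_{j_s}ᵀ/‖x_{j_s}‖² ∈ ℝ^{n×n} and b_s = ((x_{j_s}ᵀy − λσ_s)/‖x_{j_s}‖²) x_{j_s} ∈ ℝ^n. Then X β̃^{(S)}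 = A Xβ̃^{(0)} + b, where A = A_S A_{S−1} ⋯ A_1 and b = b_S + A_S b_{S−1} + A_S A_{S−1} b_{S−2} + … + A_S ⋯ A_2 b_1. -/
open Finset Matrix

/-- Soft-thresholding of `x` at level `ν`: `ST(x, ν) = sign(x)·max(0, |x| − ν)`. -/
noncomputable def softThresh (x ν : ℝ) : ℝ := Real.sign x * max 0 (|x| - ν)

/-- Where it does not vanish, soft-thresholding is a shift by the level towards zero. -/
theorem softThresh_eq_sub_mul_sign {x ν : ℝ} (h : softThresh x ν ≠ 0) :
    softThresh x ν = x - ν * Real.sign (softThresh x ν) := by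
  unfold softThresh at *
  have hm : 0 < |x| - ν := by
    by_contra! hle
    exact h (by rw [max_eq_left hle, mul_zero])
  rw [max_eq_right hm.le] at *
  rcases lt_trichotomy x 0 with hx | rfl | hx
  · rw [abs_of_neg hx] at *
    rw [Real.sign_of_neg hx, Real.sign_of_neg (by linarith : -1 * (-x - ν) < 0)]
    ring
  · simp at h
  · rw [abs_of_pos hx] at *
    rw [Real.sign_of_pos hx, one_mul, Real.sign_of_pos hm]
    ring

/-- Closed form of a finite affine recursion `u (s + 1) = A s *ᵥ u s + b s`. -/
theorem mulVec_affine_recursion {m R : Type*} [Fintype m] [DecidableEq m] [CommRing R] {S : ℕ}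
    (A : Fin S → Matrix m m R) (b : Fin S → m → R) (u : Fin (S + 1) → m → R)
    (hu : ∀ s : Fin S, u s.succ = (A s).mulVec (u s.castSucc) + b s) :
    u (Fin.last S) = (List.ofFn A).reverse.prod.mulVec (u 0) +
      ∑ s : Fin S, ((List.ofFn A).drop ((s : ℕ) + 1)).reverse.prod.mulVec (b s) := by
  induction S with
  | zero => simp
  | succ S ih =>
    have htail := ih (fun s => A s.succ) (fun s => b s.succ) (fun s => u s.succ)
      (fun s => by simpa using hu s.succ)
    have hhead : u (Fin.succ 0) = (A 0).mulVec (u 0) + b 0 := hu 0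
    rw [Fin.succ_last, hhead] at htail
    rw [htail, Fin.sum_univ_succ, List.ofFn_succ]
    simp [Matrix.mulVec_add, Matrix.mulVec_mulVec, add_assoc]

/-- Changing one coordinate of `v` moves `X *ᵥ v` along the corresponding column of `X`. -/
theorem mulVec_eq_add_smul_col_of_eq_off {m k R : Type*} [Fintype k] [DecidableEq k] [CommRing R]
    (X : Matrix m k R) {v w : k → R} {j : k} (h : ∀ l, l ≠ j → w l = v l) :
    X.mulVec w = X.mulVec v + (w j - v j) • fun i => X i j := by
  have hw : w = v + Pi.single j (w j - v j) := by
    ext l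
    by_cases hl : l = j
    · subst hl; simp
    · simp [hl, h l hl]
  conv_lhs => rw [hw]
  rw [Matrix.mulVec_add, Matrix.mulVec_single]
  ext i
  simp [mul_comm]

/-- VAR structure of one epoch of cyclic coordinate descent for the Lasso after sign
identification: starting from `β̃^{(0)}` supported on `{j_1 < … < j_S}` and performing
the soft-thresholding updates of coordinates `j_1, …, j_S` in order, if each updated
coordinate has the identified sign `σ_s`, then
`Xβ̃^{(S)} = A_S⋯A_1 (Xβ̃^{(0)}) + (b_S + A_S b_{S−1} + … + A_S⋯A_2 b_1)`, where
`A_s = Id − x_{j_s}x_{j_s}ᵀ/‖x_{j_s}‖²` and `b_s = ((x_{j_s}ᵀy − λσ_s)/‖x_{j_s}‖²) x_{j_s}`. -/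
theorem lasso_cd_epoch_var (n p S : ℕ) (X : Matrix (Fin n) (Fin p) ℝ) (y : Fin n → ℝ)
    (lam : ℝ) (hlam : 0 < lam)
    (j : Fin S → Fin p) (hj : StrictMono j)
    (hx : ∀ s, (fun i => X i (j s)) ≠ 0)
    (σ : Fin S → ℝ) (hσ : ∀ s, σ s = 1 ∨ σ s = -1)
    (B : Fin (S + 1) → Fin p → ℝ)
    (hsupp : ∀ l, B 0 l ≠ 0 → ∃ s, j s = l)
    (hupd_other : ∀ (s : Fin S) (l : Fin p), l ≠ j s → B s.succ l = B s.castSucc l)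
    (hupd : ∀ s : Fin S,
      B s.succ (j s) =
        softThresh (B s.castSucc (j s) +
            (∑ i, X i (j s) * (y i - X.mulVec (B s.castSucc) i)) / (∑ i, (X i (j s)) ^ 2))
          (lam / (∑ i, (X i (j s)) ^ 2)))
    (hsign : ∀ s : Fin S, Real.sign (B s.succ (j s)) = σ s) :
    X.mulVec (B (Fin.last S)) =
      ((List.ofFn fun s : Fin S =>
          (1 : Matrix (Fin n) (Fin n) ℝ) -
            (∑ i, (X i (j s)) ^ 2)⁻¹ •
              vecMulVec (fun i => X i (j s)) (fun i => X i (j s))).reverse.prod).mulVec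
        (X.mulVec (B 0)) +
      ∑ s : Fin S,
        (((List.ofFn fun r : Fin S =>
            (1 : Matrix (Fin n) (Fin n) ℝ) -
              (∑ i, (X i (j r)) ^ 2)⁻¹ •
                vecMulVec (fun i => X i (j r)) (fun i => X i (j r))).drop
            ((s : ℕ) + 1)).reverse.prod).mulVec
          ((((∑ i, X i (j s) * y i) - lam * σ s) / (∑ i, (X i (j s)) ^ 2)) •
            fun i => X i (j s)) := by
  refine mulVec_affine_recursion _ (fun s => (((∑ i, X i (j s) * y i) - lam * σ s) /
    (∑ i, (X i (j s)) ^ 2)) • fun i => X i (j s)) (fun s => X.mulVec (B s)) fun s => ?_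
  have hne : B s.succ (j s) ≠ 0 := by
    intro h0
    have := hsign s
    rw [h0, Real.sign_zero] at this
    rcases hσ s with h | h <;> rw [h] at this <;> norm_num at this
  have hval := softThresh_eq_sub_mul_sign (hupd s ▸ hne)
  rw [← hupd s, hsign s] at hval
  simp only [mulVec_eq_add_smul_col_of_eq_off X (hupd_other s), hval, Matrix.sub_mulVec,
    Matrix.one_mulVec, Matrix.smul_mulVec, Matrix.vecMulVec_mulVec]
  ext i
  simp only [Pi.add_apply, Pi.sub_apply, Pi.smul_apply, smul_eq_mul, MulOpposite.smul_eq_mul_unop,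
    MulOpposite.unop_op, dotProduct, mul_sub, Finset.sum_sub_distrib]
  ring
end

section
/- VAR structure of proximal gradient descent for the Lasso after sign identification: let S ⊆ [p], let X_S ∈ ℝ^{n×|S|} be X restricted to the columns in S, let σ ∈ {−1,+1}^{|S|}, and let L > 0. Let β ∈ ℝ^p have support contained in S, and define β⁺ ∈ ℝ^p componentwise by β⁺_j = ST(β_j − (1/L)x_jᵀ(Xβ − y), λ/L). Assume that β⁺_j = 0 for all j ∉ S and that for each j ∈ S, β⁺_j ≠ 0 with sign(β⁺_j) = σ_j. Then Xβ⁺ = (Id_n − (1/L) X_S X_Sᵀ) Xβ + (1/L) X_S X_Sᵀ y − (λ/L) X_S σ. -/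
open Finset Matrix

theorem mulVec_apply_eq_sum_of_forall_notMem_eq_zero {m q : Type*} [Fintype q]
    (X : Matrix m q ℝ) {S : Finset q} {v : q → ℝ} (hv : ∀ j ∉ S, v j = 0) (i : m) :
    X.mulVec v i = ∑ j ∈ S, X i j * v j :=
  (Finset.sum_subset (Finset.subset_univ S) fun j _ hj => by simp [hv j hj]).symm

theorem sum_gram_mul_eq_sum_mul_sum {m q : Type*} [Fintype m]
    (X : Matrix m q ℝ) (S : Finset q) (w : m → ℝ) (i : m) :
    ∑ k, (∑ j ∈ S, X i j * X k j) * w k = ∑ j ∈ S, X i j * ∑ k, X k j * w k := by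
  simp_rw [Finset.sum_mul, Finset.mul_sum, mul_assoc]
  exact Finset.sum_comm

/-- VAR structure of proximal gradient descent for the Lasso after sign identification:
if `β` is supported on `S`, the proximal gradient step `β⁺` (soft-thresholding of a
gradient step with step size `1/L`) vanishes outside `S` and has identified signs
`σ_j` on `S`, then `Xβ⁺ = (Id − (1/L) X_S X_Sᵀ) Xβ + (1/L) X_S X_Sᵀ y − (λ/L) X_S σ`. -/
theorem lasso_pg_var (n p : ℕ) (X : Matrix (Fin n) (Fin p) ℝ) (y : Fin n → ℝ)
    (lam : ℝ) (hlam : 0 < lam) (L : ℝ) (hL : 0 < L)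
    (S : Finset (Fin p)) (σ : Fin p → ℝ) (hσ : ∀ j ∈ S, σ j = 1 ∨ σ j = -1)
    (beta : Fin p → ℝ) (hsupp : ∀ j ∉ S, beta j = 0)
    (betap : Fin p → ℝ)
    (hdef : ∀ j, betap j =
      softThresh (beta j - (1 / L) * ∑ i, X i j * (X.mulVec beta i - y i)) (lam / L))
    (hzero : ∀ j ∉ S, betap j = 0)
    (hsign : ∀ j ∈ S, betap j ≠ 0 ∧ Real.sign (betap j) = σ j) :
    X.mulVec betap =
      (fun i => X.mulVec beta i
          - (1 / L) * ∑ i', (∑ j ∈ S, X i j * X i' j) * X.mulVec beta i'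
          + (1 / L) * ∑ i', (∑ j ∈ S, X i j * X i' j) * y i'
          - (lam / L) * ∑ j ∈ S, X i j * σ j) := by
  funext i
  have hstep : ∀ j ∈ S, betap j = beta j - (1 / L) * ∑ k, X k j * X.mulVec beta k
      + (1 / L) * ∑ k, X k j * y k - (lam / L) * σ j := by
    intro j hj
    obtain ⟨hne, hsgn⟩ := hsign j hj
    rw [hdef j] at hne hsgn ⊢
    rw [softThresh_eq_sub_mul_sign hne, hsgn]
    simp only [mul_sub, Finset.sum_sub_distrib]
    ring
  rw [mulVec_apply_eq_sum_of_forall_notMem_eq_zero X hzero,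
    sum_gram_mul_eq_sum_mul_sum, sum_gram_mul_eq_sum_mul_sum]
  conv_rhs => enter [1, 1, 1]; rw [mulVec_apply_eq_sum_of_forall_notMem_eq_zero X hsupp]
  rw [Finset.mul_sum S, Finset.mul_sum S, Finset.mul_sum S, ← Finset.sum_sub_distrib,
    ← Finset.sum_add_distrib, ← Finset.sum_sub_distrib]
  refine Finset.sum_congr rfl fun j hj => ?_
  rw [hstep j hj]
  ring
end

section
/- Orthogonality of the VAR offset to the fixed-point space, coordinate descent case: let x_1, …, x_S ∈ ℝ^n be nonzero, A_s = Id_n − x_s x_sᵀ/‖x_s‖², A = A_S ⋯ A_1, and let b_s ∈ ℝ^n be collinear with x_s for each s ∈ [S]. Set b = b_S + A_S b_{S−1} + … + A_S ⋯ A_2 b_1. Then for every v ∈ ℝ^n with Av = v, one has vᵀb = 0; that is, b is orthogonal to Ker(Id_n − A). -/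
open Finset Matrix

/-- Orthogonal projection onto the hyperplane orthogonal to `x`:
`Id − xxᵀ/‖x‖²`. -/
noncomputable def projMat {n : ℕ} (x : Fin n → ℝ) : Matrix (Fin n) (Fin n) ℝ :=
  1 - (∑ i, (x i) ^ 2)⁻¹ • Matrix.vecMulVec x x

theorem dotProduct_self_nonneg_real {n : ℕ} (x : Fin n → ℝ) : 0 ≤ x ⬝ᵥ x :=
  Finset.sum_nonneg fun i _ => mul_self_nonneg (x i)

theorem projMat_mulVec {n : ℕ} (x v : Fin n → ℝ) :
    projMat x *ᵥ v = v - ((x ⬝ᵥ x)⁻¹ * (x ⬝ᵥ v)) • x := by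
  have h : ∑ i, x i ^ 2 = x ⬝ᵥ x := by simp only [dotProduct, sq]
  simp [projMat, h, sub_mulVec, smul_mulVec, vecMulVec_mulVec, smul_smul]

theorem vecMul_projMat {n : ℕ} (x v : Fin n → ℝ) : v ᵥ* projMat x = projMat x *ᵥ v := by
  rw [← mulVec_transpose]
  simp [projMat]

theorem projMat_mulVec_eq_self {n : ℕ} {x v : Fin n → ℝ} (h : x ⬝ᵥ v = 0) :
    projMat x *ᵥ v = v := by
  simp [projMat_mulVec, h]

theorem projMat_mulVec_dotProduct_self {n : ℕ} {x : Fin n → ℝ} (hx : x ≠ 0) (v : Fin n → ℝ) :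
    (projMat x *ᵥ v) ⬝ᵥ (projMat x *ᵥ v) = v ⬝ᵥ v - (x ⬝ᵥ x)⁻¹ * (x ⬝ᵥ v) ^ 2 := by
  have hq : x ⬝ᵥ x ≠ 0 := by simpa using hx
  simp only [projMat_mulVec, dotProduct_sub, sub_dotProduct, smul_dotProduct, dotProduct_smul,
    smul_eq_mul, dotProduct_comm v x]
  field_simp
  ring

/-- A product of hyperplane projections does not increase the Euclidean norm. -/
theorem reverse_prod_projMat_mulVec_dotProduct_self_le {n : ℕ} (l : List (Fin n → ℝ))
    (hl : ∀ x ∈ l, x ≠ 0) (v : Fin n → ℝ) :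
    ((l.map projMat).reverse.prod *ᵥ v) ⬝ᵥ ((l.map projMat).reverse.prod *ᵥ v) ≤ v ⬝ᵥ v := by
  induction l generalizing v with
  | nil => simp
  | cons x l ih =>
    rw [List.forall_mem_cons] at hl
    simp only [List.map_cons, List.reverse_cons, List.prod_append, List.prod_singleton,
      ← mulVec_mulVec]
    refine (ih hl.2 _).trans ?_
    rw [projMat_mulVec_dotProduct_self hl.1]
    have hq : 0 ≤ x ⬝ᵥ x := dotProduct_self_nonneg_real x
    have : 0 ≤ (x ⬝ᵥ x)⁻¹ * (x ⬝ᵥ v) ^ 2 := by positivity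
    linarith

/-- A product of hyperplane projections preserves the norm of `v` only if `v` lies in every
hyperplane. -/
theorem dotProduct_eq_zero_of_le_reverse_prod_projMat {n : ℕ} (l : List (Fin n → ℝ))
    (hl : ∀ x ∈ l, x ≠ 0) (v : Fin n → ℝ)
    (hv : v ⬝ᵥ v ≤
      ((l.map projMat).reverse.prod *ᵥ v) ⬝ᵥ ((l.map projMat).reverse.prod *ᵥ v)) :
    ∀ x ∈ l, x ⬝ᵥ v = 0 := by
  induction l with
  | nil => simp
  | cons x l ih =>
    rw [List.forall_mem_cons] at hl ⊢
    simp only [List.map_cons, List.reverse_cons, List.prod_append, List.prod_singleton,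
      ← mulVec_mulVec] at hv
    have hxv : x ⬝ᵥ v = 0 := by
      have h := hv.trans (reverse_prod_projMat_mulVec_dotProduct_self_le l hl.2 _)
      rw [projMat_mulVec_dotProduct_self hl.1] at h
      have hq : 0 < x ⬝ᵥ x :=
        (dotProduct_self_nonneg_real x).lt_of_ne' (by simpa using hl.1)
      by_contra hne
      have : 0 < (x ⬝ᵥ x)⁻¹ * (x ⬝ᵥ v) ^ 2 := by positivity
      linarith
    rw [projMat_mulVec_eq_self hxv] at hv
    exact ⟨hxv, ih hl.2 hv⟩

theorem vecMul_list_prod_eq_self {n : ℕ} {v : Fin n → ℝ} (L : List (Matrix (Fin n) (Fin n) ℝ))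
    (h : ∀ M ∈ L, v ᵥ* M = v) : v ᵥ* L.prod = v := by
  induction L with
  | nil => simp
  | cons M L ih =>
    rw [List.forall_mem_cons] at h
    rw [List.prod_cons, ← vecMul_vecMul, h.1, ih h.2]

/-- Orthogonality of the VAR offset to the fixed-point space (coordinate descent
case): with `A = A_S⋯A_1`, `A_s = Id − x_s x_sᵀ/‖x_s‖²`, and each `b_s` collinear with
`x_s`, the offset `b = b_S + A_S b_{S−1} + … + A_S⋯A_2 b_1` is orthogonal to
`Ker(Id − A)`: every `v` with `Av = v` satisfies `vᵀb = 0`. -/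
theorem var_offset_orthogonal_cd (n S : ℕ)
    (x : Fin S → Fin n → ℝ) (hx : ∀ s, x s ≠ 0)
    (b : Fin S → Fin n → ℝ) (hb : ∀ s, ∃ c : ℝ, b s = c • x s) :
    ∀ v : Fin n → ℝ,
      ((List.ofFn fun s : Fin S => projMat (x s)).reverse.prod).mulVec v = v →
      ∑ i, v i *
        (∑ s : Fin S,
          (((List.ofFn fun r : Fin S => projMat (x r)).drop ((s : ℕ) + 1)).reverse.prod).mulVec
            (b s)) i = 0 := by
  intro v hv
  have hofFn : (List.ofFn fun s => projMat (x s)) = (List.ofFn x).map projMat := by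
    rw [List.map_ofFn]; rfl
  rw [hofFn] at hv ⊢
  have horth : ∀ y ∈ List.ofFn x, y ⬝ᵥ v = 0 :=
    dotProduct_eq_zero_of_le_reverse_prod_projMat _ (by simpa [List.mem_ofFn] using hx) v
      (by rw [hv])
  change v ⬝ᵥ _ = 0
  rw [dotProduct_sum]
  refine Finset.sum_eq_zero fun s _ => ?_
  rw [dotProduct_mulVec, vecMul_list_prod_eq_self]
  · obtain ⟨c, hc⟩ := hb s
    rw [hc, dotProduct_smul, dotProduct_comm, horth _ (List.mem_ofFn.2 ⟨s, rfl⟩), smul_zero]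
  · intro M hM
    obtain ⟨y, hy, rfl⟩ := List.mem_map.1 (List.mem_of_mem_drop (List.mem_reverse.1 hM))
    rw [vecMul_projMat, projMat_mulVec_eq_self (horth y hy)]
end

section
/- Soft-thresholding separation inequality: let ν > 0 and x, y ∈ ℝ. If ST(x, ν) ≠ 0 and ST(y, ν) = 0, then |ST(x, ν) − ST(y, ν)| ≤ |x − y| − (ν − |y|). -/
/-- Where soft-thresholding does not vanish, it shrinks the absolute value by exactly `ν`. -/
theorem abs_softThresh_of_ne_zero {x ν : ℝ} (h : softThresh x ν ≠ 0) :
    |softThresh x ν| = |x| - ν := by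
  unfold softThresh at h ⊢
  obtain ⟨hsign, hmax⟩ := mul_ne_zero_iff.mp h
  have hpos : 0 < |x| - ν := by
    by_contra! hle
    exact hmax (max_eq_left hle)
  have habs : |Real.sign x| = 1 := by
    rcases Real.sign_apply_eq x with hs | hs | hs
    · simp [hs]
    · exact absurd hs hsign
    · simp [hs]
  rw [abs_mul, habs, one_mul, max_eq_right hpos.le, abs_of_pos hpos]

/-- Soft-thresholding separation inequality: if `ν > 0`, `ST(x, ν) ≠ 0` and
`ST(y, ν) = 0`, then `|ST(x, ν) − ST(y, ν)| ≤ |x − y| − (ν − |y|)`. -/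
theorem softThresh_separation (ν x y : ℝ) (hν : 0 < ν)
    (hx : softThresh x ν ≠ 0) (hy : softThresh y ν = 0) :
    |softThresh x ν - softThresh y ν| ≤ |x - y| - (ν - |y|) := by
  rw [hy, sub_zero, abs_softThresh_of_ne_zero hx]
  linarith [abs_sub_abs_le_abs_sub x y]
end

section
/- Sign identification for cyclic coordinate descent on a sparse GLM: let γ > 0, and for i ∈ [n] let f_i : ℝ → ℝ be convex and differentiable with (1/γ)-Lipschitz derivative; write F(u) = Σ_{i=1}^n f_i(u_i) and ∇F(u) = (f_1'(u_1), …, f_n'(u_n)). Let X ∈ ℝ^{n×p} have nonzero columns x_1,…,x_p and let λ > 0. Assume β̂ is the unique minimizer of P(β) = F(Xβ) + λ‖β‖₁, and that it is non-degenerate: for every j ∈ [p], β̂_j = 0 implies |x_jᵀ∇F(Xβ̂)| < λ. Let (β^{(t)})_{t∈ℕ} be produced by cyclic coordinate descent, where β^{(t+1)} is obtained from β^{(t)} by successively updating coordinates j = 1, …, p via β_j ← ST(β_j − (γ/‖x_j‖²) x_jᵀ∇F(Xβ), γλ/‖x_j‖²), and assume β^{(t)} → β̂. Then there exists T ∈ ℕ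 such that for all t ≥ T and all j ∈ [p], sign(β^{(t)}_j) = sign(β̂_j). -/
open Finset Matrix

/-- One epoch of cyclic coordinate descent for the sparse GLM
`min_β Σ_i f_i((Xβ)_i) + λ‖β‖₁`: the coordinates `j = 1, …, p` are successively
updated via `β_j ← ST(β_j − (γ/‖x_j‖²) x_jᵀ∇F(Xβ), γλ/‖x_j‖²)`. -/
noncomputable def cdEpoch (n p : ℕ) (X : Matrix (Fin n) (Fin p) ℝ)
    (f : Fin n → ℝ → ℝ) (γ lam : ℝ) (beta : Fin p → ℝ) : Fin p → ℝ :=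
  (List.finRange p).foldl
    (fun b j => Function.update b j
      (softThresh
        (b j - (γ / ∑ i, (X i j) ^ 2) * ∑ i, X i j * deriv (f i) (X.mulVec b i))
        (γ * lam / ∑ i, (X i j) ^ 2))) beta

/-- Successively updating the coordinates in a duplicate-free list: each listed coordinate ends up
with the value computed from a point mixing coordinates of the initial and final points. -/
theorem foldl_update_mixed {ι α : Type*} [DecidableEq ι] (u : (ι → α) → ι → α) (l : List ι)
    (hl : l.Nodup) (b₀ : ι → α) :
    (∀ k ∉ l, l.foldl (fun b j => Function.update b j (u b j)) b₀ k = b₀ k) ∧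
    ∀ j ∈ l, ∃ b : ι → α,
      (∀ k, b k = b₀ k ∨ b k = l.foldl (fun b j => Function.update b j (u b j)) b₀ k) ∧
      l.foldl (fun b j => Function.update b j (u b j)) b₀ j = u b j := by
  induction l generalizing b₀ with
  | nil => simp
  | cons a l ih =>
    obtain ⟨ha, hl⟩ := List.nodup_cons.mp hl
    obtain ⟨h₁, h₂⟩ := ih hl (Function.update b₀ a (u b₀ a))
    simp only [List.foldl_cons]
    refine ⟨fun k hk => ?_, fun j hj => ?_⟩
    · rw [List.mem_cons, not_or] at hk
      rw [h₁ k hk.2, Function.update_of_ne hk.1]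
    · rcases List.mem_cons.mp hj with rfl | hj
      · exact ⟨b₀, fun k => Or.inl rfl, by rw [h₁ j ha, Function.update_self]⟩
      · obtain ⟨b, hb, hbj⟩ := h₂ j hj
        refine ⟨b, fun k => ?_, hbj⟩
        rcases eq_or_ne k a with rfl | hk
        · rcases hb k with h | h
          · exact Or.inr (h.trans (h₁ k ha).symm)
          · exact Or.inr h
        · simpa [Function.update_of_ne hk] using hb k

theorem softThresh_eq_zero {x ν : ℝ} (h : |x| ≤ ν) : softThresh x ν = 0 := by
  simp [softThresh, max_eq_left (sub_nonpos.mpr h)]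

theorem Real.eventually_sign_eq {x : ℝ} (hx : x ≠ 0) :
    ∀ᶠ y in nhds x, Real.sign y = Real.sign x := by
  rcases hx.lt_or_gt with h | h
  · filter_upwards [Iio_mem_nhds h] with y hy
    rw [Real.sign_of_neg h, Real.sign_of_neg hy]
  · filter_upwards [Ioi_mem_nhds h] with y hy
    rw [Real.sign_of_pos h, Real.sign_of_pos hy]

theorem continuous_of_abs_sub_le {g : ℝ → ℝ} {K : ℝ}
    (h : ∀ a b, |g a - g b| ≤ K * |a - b|) : Continuous g :=
  (LipschitzWith.of_dist_le' (K := K) fun a b => by simpa [Real.dist_eq] using h a b).continuous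

/-- If a sequence converges, so do sequences mixing coordinates of consecutive terms. -/
theorem eventually_forall_mixed {ι : Type*} [Fintype ι] {x : ℕ → ι → ℝ} {a : ι → ℝ}
    (hx : Filter.Tendsto x Filter.atTop (nhds a)) {P : (ι → ℝ) → Prop}
    (hP : ∀ᶠ b in nhds a, P b) :
    ∀ᶠ t in Filter.atTop, ∀ b : ι → ℝ, (∀ k, b k = x t k ∨ b k = x (t + 1) k) → P b := by
  obtain ⟨ε, hε, hball⟩ := Metric.eventually_nhds_iff.mp hP
  have h := hx.eventually (Metric.ball_mem_nhds a hε)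
  filter_upwards [h, (Filter.tendsto_add_atTop_nat 1).eventually h] with t h₀ h₁ b hb
  refine hball ((dist_pi_lt_iff hε).mpr fun k => ?_)
  rcases hb k with h | h <;> rw [h]
  · exact (dist_pi_lt_iff hε).mp h₀ k
  · exact (dist_pi_lt_iff hε).mp h₁ k

/-- Sign identification for cyclic coordinate descent on a sparse GLM: if each `f_i`
is convex and differentiable with `(1/γ)`-Lipschitz derivative, `β̂` is the unique
minimizer of `P(β) = Σ_i f_i((Xβ)_i) + λ‖β‖₁` and is non-degenerate
(`β̂_j = 0 ⟹ |x_jᵀ∇F(Xβ̂)| < λ`), and the cyclic coordinate descent iterates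
`β^{(t)}` converge to `β̂`, then after finitely many epochs all iterates have the
signs of `β̂`. -/
theorem sign_identification_cd (n p : ℕ) (γ : ℝ) (hγ : 0 < γ)
    (f : Fin n → ℝ → ℝ)
    (hdiff : ∀ i, Differentiable ℝ (f i))
    (hconv : ∀ i, ConvexOn ℝ Set.univ (f i))
    (hlip : ∀ i, ∀ a b : ℝ, |deriv (f i) a - deriv (f i) b| ≤ (1 / γ) * |a - b|)
    (X : Matrix (Fin n) (Fin p) ℝ) (hX : ∀ j, (fun i => X i j) ≠ 0)
    (lam : ℝ) (hlam : 0 < lam)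
    (betah : Fin p → ℝ)
    (hmin : ∀ beta : Fin p → ℝ, beta ≠ betah →
      (∑ i, f i (X.mulVec betah i)) + lam * ∑ j, |betah j| <
        (∑ i, f i (X.mulVec beta i)) + lam * ∑ j, |beta j|)
    (hnd : ∀ j, betah j = 0 → |∑ i, X i j * deriv (f i) (X.mulVec betah i)| < lam)
    (beta : ℕ → Fin p → ℝ)
    (hiter : ∀ t, beta (t + 1) = cdEpoch n p X f γ lam (beta t))
    (htends : Filter.Tendsto beta Filter.atTop (nhds betah)) :
    ∃ T : ℕ, ∀ t, T ≤ t → ∀ j, Real.sign (beta t j) = Real.sign (betah j) := by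
  have key : ∀ j, ∀ᶠ t in Filter.atTop, Real.sign (beta t j) = Real.sign (betah j) := by
    intro j
    by_cases hj : betah j = 0
    · have hpos : 0 < ∑ i, (X i j) ^ 2 := by
        obtain ⟨i, hi⟩ := Function.ne_iff.mp (hX j)
        exact Finset.sum_pos' (fun i _ => sq_nonneg _)
          ⟨i, Finset.mem_univ i, sq_pos_of_ne_zero hi⟩
      have hcont : Continuous fun b : Fin p → ℝ =>
          |b j - (γ / ∑ i, (X i j) ^ 2) * ∑ i, X i j * deriv (f i) (X.mulVec b i)| := by
        have hmul : ∀ i, Continuous fun b : Fin p → ℝ => X.mulVec b i := fun i =>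
          (continuous_apply i).comp (Continuous.matrix_mulVec continuous_const continuous_id)
        have hd : ∀ i, Continuous fun b : Fin p → ℝ => deriv (f i) (X.mulVec b i) := fun i =>
          (continuous_of_abs_sub_le (hlip i)).comp (hmul i)
        fun_prop
      have hlt : |betah j - (γ / ∑ i, (X i j) ^ 2) *
          ∑ i, X i j * deriv (f i) (X.mulVec betah i)| < γ * lam / ∑ i, (X i j) ^ 2 := by
        rw [hj, zero_sub, abs_neg, abs_mul, abs_of_pos (div_pos hγ hpos), mul_div_right_comm]
        exact mul_lt_mul_of_pos_left (hnd j hj) (div_pos hγ hpos)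
      have hev := eventually_forall_mixed htends
        (hcont.continuousAt.eventually (Iio_mem_nhds hlt))
      rw [← Filter.map_add_atTop_eq_nat 1, Filter.eventually_map]
      filter_upwards [hev] with t ht
      obtain ⟨b, hb, hbj⟩ := (foldl_update_mixed
        (fun (b : Fin p → ℝ) j => softThresh
          (b j - (γ / ∑ i, (X i j) ^ 2) * ∑ i, X i j * deriv (f i) (X.mulVec b i))
          (γ * lam / ∑ i, (X i j) ^ 2))
        (List.finRange p) (List.nodup_finRange p) (beta t)).2 j (List.mem_finRange j)
      have hzero : beta (t + 1) j = 0 := by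
        rw [hiter t]
        refine hbj.trans (softThresh_eq_zero (le_of_lt (ht b fun k => ?_)))
        rw [hiter t]
        exact hb k
      rw [hzero, hj]
    · exact (tendsto_pi_nhds.mp htends j).eventually (Real.eventually_sign_eq hj)
  exact Filter.eventually_atTop.mp (Filter.eventually_all.mpr key)
end
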